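/- One has [M_{p,2} : K] = q, and every intermediate field F with K ⊆ F ⊆ M_{p,2} and [F : K] = p is equal to M_{v^{1−p}} for some v ∈ μ_{q−1}; consequently the map v ↦ M_{v^{1−p}} induces a bijection from μ_{q−1}/μ_{p−1} onto the set of intermediate fields of M_{p,2}/K of degree p over K. -/

import Mathlib

open Polynomial Filter IntermediateField

variable (p : ℕ) [Fact p.Prime]

/-- A fixed algebraic closure of `ℚ_p`. -/
noncomputable abbrev Qpbar := AlgebraicClosure ℚ_[p]

/-- The unramified extension `K` of `ℚ_p` of degree `d` inside `ℚ̄_p`, realized as the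
splitting field of `X^(p^d - 1) - 1`. -/
noncomputable def Kur (d : ℕ) : IntermediateField ℚ_[p] (Qpbar p) :=
  IntermediateField.adjoin ℚ_[p] {x : Qpbar p | x ^ (p ^ d - 1) = 1}

/-- `ψ_u(X) = X (X + u p)^{p-1} + p` as a polynomial over `ℚ̄_p`. -/
noncomputable def psiPoly (u : Qpbar p) : Polynomial (Qpbar p) :=
  X * (X + C (u * (p : Qpbar p))) ^ (p - 1) + C (p : Qpbar p)

/-- `M_u`: the splitting field of `ψ_u` over `K` inside `ℚ̄_p`. -/
noncomputable def Mfield (d : ℕ) (u : Qpbar p) : IntermediateField (Kur p d) (Qpbar p) :=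
  IntermediateField.adjoin (Kur p d) {x : Qpbar p | (psiPoly p u).IsRoot x}

/-- `M_{p,2}`: the splitting field of `X (X+p)^{q-1} + p` over `K` inside `ℚ̄_p`. -/
noncomputable def Mp2K (d : ℕ) : IntermediateField (Kur p d) (Qpbar p) :=
  IntermediateField.adjoin (Kur p d)
    {x : Qpbar p | (X * (X + C (p : Qpbar p)) ^ (p ^ d - 1) + C (p : Qpbar p) :
      Polynomial (Qpbar p)).IsRoot x}

section helpers
variable {p}

lemma norm_p_Q : ‖(p : Qpbar p)‖ = (p : ℝ)⁻¹ := by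
  rw [← map_natCast (algebraMap ℚ_[p] (Qpbar p)), norm_algebraMap', Padic.norm_p]

lemma nsub_le_max (x y : Qpbar p) : ‖x - y‖ ≤ max ‖x‖ ‖y‖ := by
  rw [sub_eq_add_neg, ← norm_neg y]
  exact IsUltrametricDist.norm_add_le_max _ _

lemma nadd_lt {x y : Qpbar p} {c : ℝ} (hx : ‖x‖ < c) (hy : ‖y‖ < c) : ‖x + y‖ < c :=
  (IsUltrametricDist.norm_add_le_max _ _).trans_lt (max_lt hx hy)

lemma nsub_lt {x y : Qpbar p} {c : ℝ} (hx : ‖x‖ < c) (hy : ‖y‖ < c) : ‖x - y‖ < c :=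
  (nsub_le_max _ _).trans_lt (max_lt hx hy)

lemma nadd_le {x y : Qpbar p} {c : ℝ} (hx : ‖x‖ ≤ c) (hy : ‖y‖ ≤ c) : ‖x + y‖ ≤ c :=
  (IsUltrametricDist.norm_add_le_max _ _).trans (max_le hx hy)

lemma nsub_le {x y : Qpbar p} {c : ℝ} (hx : ‖x‖ ≤ c) (hy : ‖y‖ ≤ c) : ‖x - y‖ ≤ c :=
  (nsub_le_max _ _).trans (max_le hx hy)

lemma one_lt_pR : (1 : ℝ) < p := by exact_mod_cast (Fact.out : p.Prime).one_lt

lemma p_ne_zero_Q : (p : Qpbar p) ≠ 0 := by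
  exact_mod_cast (Fact.out : p.Prime).ne_zero

lemma two_le_pow {m : ℕ} (hm : m ≠ 0) : 2 ≤ p ^ m :=
  (Fact.out : p.Prime).two_le.trans (Nat.le_self_pow hm p)

lemma cross_lt (m : ℕ) (hm : m ≠ 0) (x y : Qpbar p) (C : ℝ)
    (hC : ∀ k, 0 < k → k < p ^ m → ‖x‖ ^ k * ‖y‖ ^ (p ^ m - k) < C) :
    ‖(x + y) ^ (p ^ m) - x ^ (p ^ m) - y ^ (p ^ m)‖ < C * (p : ℝ)⁻¹ := by
  have hp : p.Prime := Fact.out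
  have h2 := two_le_pow (p := p) hm
  have hne : (Finset.Ioo 0 (p ^ m)).Nonempty := ⟨1, by simp; omega⟩
  rw [add_pow_prime_pow_eq' hp x y m]
  rw [show ∀ a b c : Qpbar p, a + b + c - a - b = c by intros; ring, norm_mul, norm_p_Q, mul_comm]
  have hpos : 0 < (p : ℝ)⁻¹ := by have := one_lt_pR (p := p); positivity
  refine mul_lt_mul_of_pos_right ?_ hpos
  obtain ⟨k, hk, hle⟩ := IsUltrametricDist.exists_norm_finsetSum_le_of_nonempty hne
    (fun k => x ^ k * y ^ (p ^ m - k) * (((p ^ m).choose k / p : ℕ) : Qpbar p))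
  refine hle.trans_lt ?_
  rw [Finset.mem_Ioo] at hk
  refine lt_of_le_of_lt ?_ (hC k hk.1 hk.2)
  rw [norm_mul, norm_mul, norm_pow, norm_pow]
  exact mul_le_of_le_one_right (by positivity) (IsUltrametricDist.norm_natCast_le_one _ _)

lemma mono_lt {n k : ℕ} {a b P : ℝ} (ha : 0 ≤ a) (hb : 0 ≤ b) (hP : 0 < P) (hk : 0 < k)
    (hkn : k < n) (h1 : a ^ n < P) (h2 : b ^ n ≤ P) : a ^ k * b ^ (n - k) < P := by
  have hn : n ≠ 0 := by omega
  refine lt_of_pow_lt_pow_left₀ n hP.le ?_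
  have e : (a ^ k * b ^ (n - k)) ^ n = (a ^ n) ^ k * (b ^ n) ^ (n - k) := by
    rw [mul_pow, ← pow_mul, ← pow_mul, ← pow_mul, ← pow_mul, mul_comm k, mul_comm (n - k)]
  rw [e]
  calc (a ^ n) ^ k * (b ^ n) ^ (n - k) ≤ (a ^ n) ^ k * P ^ (n - k) := by gcongr
    _ < P ^ k * P ^ (n - k) := by
        gcongr
    _ = P ^ n := by rw [← pow_add]; congr 1; omega

lemma cross_lt_one {m : ℕ} (hm : m ≠ 0) {x y : Qpbar p} (hx : ‖x‖ ^ (p ^ m) < p)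
    (hy : ‖y‖ ^ (p ^ m) ≤ p) :
    ‖(x + y) ^ (p ^ m) - x ^ (p ^ m) - y ^ (p ^ m)‖ < 1 := by
  have h1 := one_lt_pR (p := p)
  have := cross_lt m hm x y p (fun k hk hkn => mono_lt (norm_nonneg _) (norm_nonneg _)
    (by linarith) hk hkn hx hy)
  rwa [mul_inv_cancel₀ (by positivity)] at this

lemma cross_le_one {m : ℕ} (hm : m ≠ 0) {x y : Qpbar p} (hx : ‖x‖ ^ (p ^ m) ≤ p)
    (hy : ‖y‖ ^ (p ^ m) ≤ p) :
    ‖(x + y) ^ (p ^ m) - x ^ (p ^ m) - y ^ (p ^ m)‖ ≤ 1 := by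
  have h1 := one_lt_pR (p := p)
  refine le_of_forall_gt_imp_ge_of_dense fun C hC => ?_
  have := cross_lt m hm x y (p * C) (fun k hk hkn => mono_lt (norm_nonneg _) (norm_nonneg _)
    (by nlinarith) hk hkn (hx.trans_lt (by nlinarith)) (hy.trans (by nlinarith)))
  rw [mul_comm, ← mul_assoc, inv_mul_cancel₀ (by positivity), one_mul] at this
  exact this.le

lemma cross_lt_self {m : ℕ} (hm : m ≠ 0) {x y : Qpbar p} (hx : ‖x‖ ^ (p ^ m) ≤ p)
    (hy : ‖y‖ ≤ 1) (hy0 : y ≠ 0) :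
    ‖(x + y) ^ (p ^ m) - x ^ (p ^ m) - y ^ (p ^ m)‖ < ‖y‖ := by
  have h1 := one_lt_pR (p := p)
  have hy0' : 0 < ‖y‖ := norm_pos_iff.2 hy0
  have := cross_lt m hm x y (‖y‖ * p) (fun k hk hkn => ?_)
  · rwa [mul_assoc, mul_inv_cancel₀ (by positivity), mul_one] at this
  · have h3 : ‖x‖ ^ k < p := by
      rcases le_or_gt ‖x‖ 1 with h | h
      · exact (pow_le_one₀ (norm_nonneg _) h).trans_lt h1
      · exact (pow_lt_pow_right₀ h hkn).trans_le hx
    have h4 : ‖y‖ ^ (p ^ m - k) ≤ ‖y‖ := pow_le_of_le_one (norm_nonneg _) hy (by omega)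
    calc ‖x‖ ^ k * ‖y‖ ^ (p ^ m - k) ≤ ‖x‖ ^ k * ‖y‖ := by gcongr
      _ < p * ‖y‖ := by gcongr
      _ = _ := mul_comm _ _

lemma norm_pow_sub {n : ℕ} (hn : 2 ≤ n) {s : Qpbar p} (h : 1 < ‖s ^ n - s‖ ∨ 1 < ‖s‖) :
    ‖s ^ n - s‖ = ‖s‖ ^ n := by
  have h1 : 1 < ‖s‖ := by
    rcases h with h | h
    · by_contra! hc
      have : ‖s ^ n - s‖ ≤ max ‖s ^ n‖ ‖s‖ :=
        nsub_le_max _ _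
      rw [norm_pow] at this
      have := pow_le_one₀ (n := n) (norm_nonneg _) hc
      simp_all
      grind
    · exact h
  have h2 : ‖s‖ < ‖s ^ n‖ := by
    rw [norm_pow]
    calc ‖s‖ = ‖s‖ ^ 1 := (pow_one _).symm
      _ < _ := pow_lt_pow_right₀ h1 (by omega)
  rw [sub_eq_add_neg, IsUltrametricDist.norm_add_eq_max_of_norm_ne_norm (by rw [norm_neg]; exact h2.ne'),
    norm_neg, max_eq_left h2.le, norm_pow]

lemma norm_root_le {n : ℕ} (hn : 2 ≤ n) {s b : Qpbar p} (h : s ^ n - s = b) (hb : ‖b‖ ≤ p) :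
    ‖s‖ ^ n ≤ p := by
  rcases le_or_gt ‖s‖ 1 with h1 | h1
  · exact (pow_le_one₀ (norm_nonneg _) h1).trans one_lt_pR.le
  · rw [← norm_pow_sub hn (Or.inr h1), h]; exact hb

lemma norm_root_eq {n : ℕ} (hn : 2 ≤ n) {s b : Qpbar p} (h : s ^ n - s = b) (hb : ‖b‖ = p) :
    ‖s‖ ^ n = p := by
  rw [← norm_pow_sub hn (Or.inl _), h, hb]
  rw [h, hb]; exact one_lt_pR

lemma diff_roots {m : ℕ} (hm : m ≠ 0) {s s' : Qpbar p} (hs : ‖s‖ ^ (p ^ m) ≤ p)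
    (hs' : ‖s'‖ ^ (p ^ m) ≤ p) (h : s ^ (p ^ m) - s = s' ^ (p ^ m) - s') :
    ‖s' - s‖ ≤ 1 ∧ ‖(s' - s) ^ (p ^ m) - (s' - s)‖ < 1 := by
  have h2 := two_le_pow (p := p) hm
  have hD : ‖s' - s‖ ^ (p ^ m) ≤ p := by
    have : ‖s' - s‖ ≤ max ‖s'‖ ‖s‖ := nsub_le_max _ _
    rcases le_max_iff.1 this with h | h
    · exact (pow_le_pow_left₀ (norm_nonneg _) h _).trans hs'
    · exact (pow_le_pow_left₀ (norm_nonneg _) h _).trans hs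
  have e : ((s + (s' - s)) ^ (p ^ m) - s ^ (p ^ m) - (s' - s) ^ (p ^ m)) =
      -((s' - s) ^ (p ^ m) - (s' - s)) := by
    rw [add_sub_cancel]; linear_combination -h
  have h3 := cross_le_one hm hs hD
  rw [e, norm_neg] at h3
  have h4 : ‖s' - s‖ ≤ 1 := by
    by_contra! hc
    rw [norm_pow_sub h2 (Or.inr hc)] at h3
    exact absurd h3 (not_le.2 (one_lt_pow₀ hc (by omega)))
  refine ⟨h4, ?_⟩
  have h5 := cross_lt_one (x := s' - s) (y := s) hm
    ((pow_le_one₀ (norm_nonneg _) h4).trans_lt one_lt_pR) hs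
  rw [← norm_neg, ← e, add_comm s, sub_right_comm]
  exact h5

lemma root_unique {m : ℕ} (hm : m ≠ 0) {s s' : Qpbar p} (hs : ‖s‖ ^ (p ^ m) ≤ p)
    (h : s ^ (p ^ m) - s = s' ^ (p ^ m) - s') (hlt : ‖s' - s‖ < 1) : s' = s := by
  by_contra hne
  have h2 := two_le_pow (p := p) hm
  have h0 : s' - s ≠ 0 := sub_ne_zero.2 hne
  have h3 := cross_lt_self hm hs hlt.le h0
  have e : ((s + (s' - s)) ^ (p ^ m) - s ^ (p ^ m) - (s' - s) ^ (p ^ m)) =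
      (s' - s) + - (s' - s) ^ (p ^ m) := by
    rw [add_sub_cancel]; linear_combination -h
  have h4 : ‖-(s' - s) ^ (p ^ m)‖ < ‖s' - s‖ := by
    rw [norm_neg, norm_pow]
    exact pow_lt_self_of_lt_one₀ (norm_pos_iff.2 h0) hlt (by omega)
  rw [e, IsUltrametricDist.norm_add_eq_max_of_norm_ne_norm h4.ne', max_eq_left h4.le] at h3
  exact lt_irrefl _ h3

lemma approx_root {n : ℕ} (hn : 2 ≤ n) {s b : Qpbar p} (h : ‖s ^ n - s - b‖ < 1) :
    ∃ s', s' ^ n - s' = b ∧ ‖s' - s‖ < 1 := by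
  set R : (Qpbar p)[X] := X ^ n - (X + C b) with hR
  have hdeg : (X + C b : (Qpbar p)[X]).degree < n := by
    rw [degree_X_add_C]; exact_mod_cast (by omega)
  have hmonic : R.Monic := monic_X_pow_sub (by
    rw [degree_X_add_C]; exact_mod_cast (by omega))
  have hsp : R.Splits := IsAlgClosed.splits R
  have hev : R.eval s = (R.roots.map (fun r => s - r)).prod := by
    rw [hsp.eval_eq_prod_roots, hmonic.leadingCoeff, one_mul]
  have hev2 : R.eval s = s ^ n - s - b := by simp [hR]; ring
  by_contra! hc
  have key : ∀ M : Multiset (Qpbar p), (∀ r ∈ M, 1 ≤ ‖s - r‖) →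
      1 ≤ ‖(M.map (fun r => s - r)).prod‖ := by
    intro M
    induction M using Multiset.induction with
    | empty => simp
    | cons a M ih =>
      intro hM
      rw [Multiset.map_cons, Multiset.prod_cons, norm_mul]
      exact one_le_mul_of_one_le_of_one_le (hM a (by simp)) (ih fun r hr => hM r (by simp [hr]))
  have := key R.roots (fun r hr => by
    rw [norm_sub_rev]
    refine hc r ?_
    have := (mem_roots'.1 hr).2
    simp [hR] at this
    linear_combination this)
  rw [← hev, hev2] at this
  linarith

lemma exists_root {n : ℕ} (hn : 2 ≤ n) (b : Qpbar p) : ∃ s : Qpbar p, s ^ n - s = b := by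
  have hm := IsAlgClosed.exists_root (X ^ n - (X + C b) : (Qpbar p)[X]) (by
    rw [degree_sub_eq_left_of_degree_lt]
    · rw [degree_X_pow]; exact_mod_cast (by omega)
    · rw [degree_X_add_C, degree_X_pow]; exact_mod_cast (by omega))
  obtain ⟨s, hs⟩ := hm
  refine ⟨s, ?_⟩
  simp at hs
  linear_combination hs

end helpers
section helpersK
variable {p}

/-- The ring generated by the `p`-adic integers and the Teichmüller elements. -/
noncomputable def Osub (p : ℕ) [Fact p.Prime] (d : ℕ) : Subring (Qpbar p) :=
  Subring.closure ({x | ∃ r : ℤ_[p], x = algebraMap ℚ_[p] (Qpbar p) (r : ℚ_[p])} ∪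
    {x | x ^ (p ^ d - 1) = 1})

lemma Osub_int (d : ℕ) (r : ℤ_[p]) : algebraMap ℚ_[p] (Qpbar p) (r : ℚ_[p]) ∈ Osub p d :=
  Subring.subset_closure (Or.inl ⟨r, rfl⟩)

lemma Osub_frob (hp : Odd p) (d : ℕ) {x : Qpbar p} (hx : x ∈ Osub p d) :
    ∃ z ∈ Osub p d, x ^ (p ^ d) = x + p * z := by
  have hpp : p.Prime := Fact.out
  unfold Osub at hx
  induction hx using Subring.closure_induction with
  | mem x hx =>
    rcases hx with ⟨r, rfl⟩ | hx
    · have h1 : (p : ℤ_[p]) ∣ r ^ (p ^ d) - r := by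
        rw [← Ideal.mem_span_singleton, ← PadicInt.maximalIdeal_eq_span_p,
          ← PadicInt.ker_toZMod, RingHom.mem_ker]
        simp
      obtain ⟨z, hz⟩ := h1
      refine ⟨_, Osub_int d z, ?_⟩
      have : (r : ℚ_[p]) ^ (p ^ d) = r + p * z := by
        rw [sub_eq_iff_eq_add'] at hz
        exact_mod_cast congrArg (fun t : ℤ_[p] => (t : ℚ_[p])) hz
      rw [← map_pow, this]
      simp
    · refine ⟨0, zero_mem _, ?_⟩
      have : p ^ d = p ^ d - 1 + 1 := by
        have : 0 < p ^ d := pow_pos hpp.pos d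
        omega
      rw [this, pow_succ, hx]; simp
  | zero => exact ⟨0, zero_mem _, by simp [hpp.ne_zero]⟩
  | one => exact ⟨0, zero_mem _, by simp⟩
  | add x y hx hy h1 h2 =>
    obtain ⟨z1, hz1, e1⟩ := h1
    obtain ⟨z2, hz2, e2⟩ := h2
    obtain ⟨r, hr⟩ := exists_add_pow_prime_pow_eq hpp (⟨x, hx⟩ : Osub p d) (⟨y, hy⟩ : Osub p d) d
    have hr' := congrArg (Subtype.val) hr
    push_cast at hr'
    refine ⟨z1 + z2 + x * y * r, add_mem (add_mem hz1 hz2) (mul_mem (mul_mem hx hy) r.2), ?_⟩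
    rw [hr', e1, e2]; ring
  | neg x hx h =>
    obtain ⟨z, hz, e⟩ := h
    refine ⟨-z, neg_mem hz, ?_⟩
    rw [(hp.pow).neg_pow, e]; ring
  | mul x y hx hy h1 h2 =>
    obtain ⟨z1, hz1, e1⟩ := h1
    obtain ⟨z2, hz2, e2⟩ := h2
    refine ⟨z1 * y + x * z2 + p * (z1 * z2), ?_, ?_⟩
    · exact add_mem (add_mem (mul_mem hz1 hy) (mul_mem hx hz2))
        (mul_mem (natCast_mem _ _) (mul_mem hz1 hz2))
    · rw [mul_pow, e1, e2]; ring

lemma Osub_frob_iter (hp : Odd p) (d N : ℕ) {x : Qpbar p} (hx : x ∈ Osub p d) :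
    ∃ z ∈ Osub p d, x ^ ((p ^ d) ^ N) = x + p * z := by
  induction N with
  | zero => exact ⟨0, zero_mem _, by simp⟩
  | succ N ih =>
    obtain ⟨z, hz, e⟩ := ih
    obtain ⟨w, hw, e2⟩ := Osub_frob hp d (pow_mem hx ((p ^ d) ^ N))
    refine ⟨z + w, add_mem hz hw, ?_⟩
    rw [pow_succ (p ^ d), pow_mul, e2, e]; ring

lemma Osub_norm (d : ℕ) (hd : 0 < d) {x : Qpbar p} (hx : x ∈ Osub p d) : ‖x‖ ≤ 1 := by
  have hpp : p.Prime := Fact.out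
  unfold Osub at hx
  induction hx using Subring.closure_induction with
  | mem x hx =>
    rcases hx with ⟨r, rfl⟩ | hx
    · rw [norm_algebraMap']; exact r.2
    · have h := congrArg norm hx
      have h2 := two_le_pow (p := p) hd.ne'
      rw [norm_pow, norm_one, pow_eq_one_iff_of_nonneg (norm_nonneg _) (by omega)] at h
      exact h.le
  | zero => simp
  | one => simp
  | add x y hx hy h1 h2 => exact nadd_le h1 h2
  | neg x hx h => rwa [norm_neg]
  | mul x y hx hy h1 h2 => rw [norm_mul]; exact mul_le_one₀ h1 (norm_nonneg _) h2

lemma coeff_minpoly_lt {x : Qpbar p} (hx : ‖x‖ < 1) {i : ℕ}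
    (hi : i < (minpoly ℚ_[p] x).natDegree) : ‖(minpoly ℚ_[p] x).coeff i‖ < 1 := by
  have h1 : spectralValueTerms (minpoly ℚ_[p] x) i ≤ ‖x‖ :=
    le_ciSup (spectralValueTerms_bddAbove (minpoly ℚ_[p] x)) i
  rw [spectralValueTerms_of_lt_natDegree _ hi] at h1
  by_contra! hc
  have : (1 : ℝ) ≤ ‖(minpoly ℚ_[p] x).coeff i‖ ^ (1 / ((minpoly ℚ_[p] x).natDegree - i : ℝ)) := by
    refine Real.one_le_rpow hc ?_
    have : (i : ℝ) < (minpoly ℚ_[p] x).natDegree := by exact_mod_cast hi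
    have : (0 : ℝ) < (minpoly ℚ_[p] x).natDegree - i := by linarith
    positivity
  linarith

lemma Osub_div (hp : Odd p) (d : ℕ) (hd : 0 < d) {x : Qpbar p} (hx : x ∈ Osub p d)
    (hlt : ‖x‖ < 1) : ∃ z ∈ Osub p d, x = p * z := by
  set P := minpoly ℚ_[p] x with hP
  have hint : IsIntegral ℚ_[p] x := Algebra.IsIntegral.isIntegral x
  have hmon : P.Monic := minpoly.monic hint
  have h1 : ∃ z ∈ Osub p d, x ^ P.natDegree = p * z := by
    have h0 : aeval x P = 0 := minpoly.aeval _ _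
    rw [aeval_eq_sum_range, Finset.sum_range_succ, hmon.coeff_natDegree, one_smul] at h0
    have h2 : ∀ i ∈ Finset.range P.natDegree, ∃ z ∈ Osub p d, P.coeff i • x ^ i = p * z := by
      intro i hi
      have hi' := coeff_minpoly_lt hlt (Finset.mem_range.1 hi)
      rw [← hP] at hi'
      have : (p : ℤ_[p]) ∣ ⟨P.coeff i, hi'.le⟩ := (PadicInt.norm_lt_one_iff_dvd _).1 hi'
      obtain ⟨c, hc⟩ := this
      have hc' : P.coeff i = p * (c : ℚ_[p]) := by
        have := congrArg (fun t : ℤ_[p] => (t : ℚ_[p])) hc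
        simpa using this
      refine ⟨algebraMap ℚ_[p] (Qpbar p) c * x ^ i, mul_mem (Osub_int d c) (pow_mem hx _), ?_⟩
      rw [hc', Algebra.smul_def, map_mul, map_natCast]; ring
    choose! z hz e using h2
    refine ⟨-∑ i ∈ Finset.range P.natDegree, z i, neg_mem (sum_mem fun i hi => hz i hi), ?_⟩
    rw [Finset.sum_congr rfl e, ← Finset.mul_sum] at h0
    linear_combination h0
  obtain ⟨z, hz, e⟩ := h1
  obtain ⟨w, hw, e2⟩ := Osub_frob_iter hp d P.natDegree hx
  have hle : P.natDegree ≤ (p ^ d) ^ P.natDegree :=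
    (Nat.lt_pow_self (by have := two_le_pow (p := p) hd.ne'; omega)).le
  refine ⟨z * x ^ ((p ^ d) ^ P.natDegree - P.natDegree) - w,
    sub_mem (mul_mem hz (pow_mem hx _)) hw, ?_⟩
  rw [← Nat.add_sub_cancel' hle, pow_add, e] at e2
  linear_combination -e2

lemma Osub_val (hp : Odd p) (d : ℕ) (hd : 0 < d) (k : ℕ) : ∀ {x : Qpbar p}, x ∈ Osub p d →
    (p : ℝ)⁻¹ ^ k ≤ ‖x‖ → ∃ j : ℕ, ‖x‖ = (p : ℝ)⁻¹ ^ j := by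
  have hp0 : (0 : ℝ) < (p : ℝ)⁻¹ := by have := one_lt_pR (p := p); positivity
  induction k with
  | zero =>
    intro x hx h
    exact ⟨0, by have := Osub_norm d hd hx; simp at h ⊢; linarith⟩
  | succ k ih =>
    intro x hx h
    rcases (Osub_norm d hd hx).lt_or_eq with h1 | h1
    · obtain ⟨z, hz, rfl⟩ := Osub_div hp d hd hx h1
      rw [norm_mul, norm_p_Q, pow_succ', mul_le_mul_iff_right₀ hp0] at h
      obtain ⟨j, hj⟩ := ih hz h
      exact ⟨j + 1, by rw [norm_mul, norm_p_Q, hj, pow_succ']⟩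
    · exact ⟨0, by simpa using h1⟩

lemma Kur_scale (d : ℕ) {x : Qpbar p} (hx : x ∈ Kur p d) :
    ∃ N : ℕ, (p : Qpbar p) ^ N * x ∈ Osub p d := by
  have hx' : x ∈ Algebra.adjoin ℚ_[p] {x : Qpbar p | x ^ (p ^ d - 1) = 1} := by
    rw [← IntermediateField.adjoin_toSubalgebra]; exact hx
  clear hx
  induction hx' using Algebra.adjoin_induction with
  | mem x h => 
    refine ⟨0, ?_⟩
    rw [pow_zero, one_mul]
    exact Subring.subset_closure (Or.inr h)
  | algebraMap r =>
    have : ∃ N : ℕ, ‖(p : ℚ_[p]) ^ N * r‖ ≤ 1 := by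
      obtain ⟨N, hN⟩ := pow_unbounded_of_one_lt ‖r‖ (one_lt_pR (p := p))
      refine ⟨N, ?_⟩
      rw [norm_mul, norm_pow, Padic.norm_p, inv_pow]
      have : (0 : ℝ) < (p : ℝ) ^ N := pow_pos (by linarith [one_lt_pR (p := p)]) _
      rw [inv_mul_le_iff₀ this]; linarith
    obtain ⟨N, hN⟩ := this
    refine ⟨N, ?_⟩
    have := Osub_int d (⟨_, hN⟩ : ℤ_[p])
    simpa using this
  | add x y hx hy h1 h2 =>
    obtain ⟨N, hN⟩ := h1
    obtain ⟨M, hM⟩ := h2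
    refine ⟨N + M, ?_⟩
    have := add_mem (mul_mem (pow_mem (natCast_mem (Osub p d) p) M) hN)
      (mul_mem (pow_mem (natCast_mem (Osub p d) p) N) hM)
    convert this using 1
    ring
  | mul x y hx hy h1 h2 =>
    obtain ⟨N, hN⟩ := h1
    obtain ⟨M, hM⟩ := h2
    refine ⟨N + M, ?_⟩
    have := mul_mem hN hM
    convert this using 1
    ring

lemma Kur_val (hp : Odd p) (d : ℕ) (hd : 0 < d) {x : Qpbar p} (hx : x ∈ Kur p d) (h0 : x ≠ 0) :
    ∃ j : ℤ, ‖x‖ = (p : ℝ) ^ j := by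
  obtain ⟨N, hN⟩ := Kur_scale d hx
  have h1 := one_lt_pR (p := p)
  have hpos : 0 < ‖(p : Qpbar p) ^ N * x‖ := by
    rw [norm_pos_iff]
    exact mul_ne_zero (pow_ne_zero _ p_ne_zero_Q) h0
  obtain ⟨k, hk⟩ := exists_pow_lt_of_lt_one hpos (inv_lt_one_of_one_lt₀ h1)
  obtain ⟨j, hj⟩ := Osub_val hp d hd k hN hk.le
  refine ⟨N - j, ?_⟩
  rw [norm_mul, norm_pow, norm_p_Q] at hj
  rw [zpow_sub₀ (by positivity), zpow_natCast, zpow_natCast]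
  rw [inv_pow, inv_pow] at hj
  field_simp at hj ⊢
  linarith

lemma Kur_lt_one (hp : Odd p) (d : ℕ) (hd : 0 < d) {x : Qpbar p} (hx : x ∈ Kur p d)
    (h : ‖x‖ < 1) : ‖x‖ ≤ (p : ℝ)⁻¹ := by
  have h1 := one_lt_pR (p := p)
  rcases eq_or_ne x 0 with rfl | h0
  · simp
  obtain ⟨j, hj⟩ := Kur_val hp d hd hx h0
  rw [hj] at h ⊢
  rw [← zpow_neg_one]
  have : j < 0 := by
    by_contra! hc
    exact absurd h (not_lt.2 (one_le_zpow₀ h1.le hc))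
  exact zpow_le_zpow_right₀ h1.le (by omega)

end helpersK
section helpersF
variable {p} {d : ℕ}

instance galK : IsGalois (Kur p d) (Qpbar p) := by
  have : IsGalois ℚ_[p] (Qpbar p) := inferInstance
  infer_instance

lemma norm_equiv (σ : Qpbar p ≃ₐ[Kur p d] Qpbar p) (x : Qpbar p) : ‖σ x‖ = ‖x‖ :=
  (spectralNorm_eq_of_equiv (σ.restrictScalars ℚ_[p]) x).symm

lemma deg_ge (hp : Odd p) (hd : 0 < d) {n : ℕ} {s : Qpbar p} (hs : ‖s‖ ^ n = p) :
    n ≤ (minpoly (Kur p d) s).natDegree := by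
  set P := minpoly (Kur p d) s with hP
  have h1 := one_lt_pR (p := p)
  have hint : IsIntegral (Kur p d) s := Algebra.IsIntegral.isIntegral s
  have hmon : P.Monic := minpoly.monic hint
  set R := P.map (algebraMap (Kur p d) (Qpbar p)) with hR
  have hRm : R.Monic := hmon.map _
  have hsp : R.Splits := IsAlgClosed.splits R
  have hroots : ∀ r ∈ R.roots, ‖r‖ = ‖s‖ := by
    intro r hr
    have hr2 := (mem_roots'.1 hr).2
    have : IsConjRoot (Kur p d) s r := by
      rw [isConjRoot_iff_aeval_eq_zero hint, aeval_def, ← eval_map]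
      exact hr2
    obtain ⟨σ, hσ⟩ := isConjRoot_iff_exists_algEquiv.1 this
    rw [← hσ, norm_equiv]
  have key : ∀ M : Multiset (Qpbar p), (∀ r ∈ M, ‖r‖ = ‖s‖) → ‖M.prod‖ = ‖s‖ ^ M.card := by
    intro M
    induction M using Multiset.induction with
    | empty => simp
    | cons a M ih =>
      intro hM
      rw [Multiset.prod_cons, norm_mul, hM a (by simp), ih fun r hr => hM r (by simp [hr]),
        Multiset.card_cons, pow_succ']
  have hc0 : R.coeff 0 = (-1) ^ R.natDegree * R.roots.prod :=
    hsp.coeff_zero_eq_prod_roots_of_monic hRm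
  have hcard : R.roots.card = P.natDegree := by
    rw [← hsp.natDegree_eq_card_roots, hR, hmon.natDegree_map]
  have hn : ‖R.coeff 0‖ = ‖s‖ ^ P.natDegree := by
    rw [hc0, norm_mul, key _ hroots, hcard]; simp
  have hs0 : 0 < ‖s‖ := by
    rcases (norm_nonneg s).eq_or_lt with h | h
    · rw [← h] at hs
      rcases Nat.eq_zero_or_pos n with h0 | h0
      · subst h0; rw [pow_zero] at hs; linarith
      · rw [zero_pow h0.ne'] at hs; linarith
    · exact h
  have hne : R.coeff 0 ≠ 0 := by
    rw [← norm_pos_iff, hn]; positivity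
  have hmem : R.coeff 0 ∈ Kur p d := by rw [hR, coeff_map]; exact (P.coeff 0).2
  obtain ⟨j, hj⟩ := Kur_val hp d hd hmem hne
  rw [hn] at hj
  have h2 : (p : ℝ) ^ (P.natDegree : ℤ) = (p : ℝ) ^ (j * n) := by
    rw [zpow_natCast, zpow_mul, ← hj, zpow_natCast, ← hs, ← pow_mul, ← pow_mul, mul_comm]
  have h3 : (P.natDegree : ℤ) = j * n := zpow_right_injective₀ (by linarith) h1.ne' h2
  have hpos : 0 < P.natDegree := minpoly.natDegree_pos hint
  have : n ∣ P.natDegree := by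
    have : (n : ℤ) ∣ P.natDegree := ⟨j, by rw [h3, mul_comm]⟩
    exact_mod_cast this
  exact Nat.le_of_dvd hpos this

lemma finrank_root (hp : Odd p) (hd : 0 < d) {n : ℕ} (hn : 2 ≤ n) {s b : Qpbar p}
    (hb : b ∈ Kur p d) (hb' : ‖b‖ = p) (hs : s ^ n - s = b) :
    Module.finrank (Kur p d) (Kur p d)⟮s⟯ = n := by
  have hint : IsIntegral (Kur p d) s := Algebra.IsIntegral.isIntegral s
  rw [IntermediateField.adjoin.finrank hint]
  refine le_antisymm ?_ (deg_ge hp hd (norm_root_eq hn hs hb'))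
  set R : (Kur p d)[X] := X ^ n - (X + C ⟨b, hb⟩) with hR
  have hdeg : (X + C ⟨b, hb⟩ : (Kur p d)[X]).degree < n := by
    rw [degree_X_add_C]; exact_mod_cast (by omega)
  have hmon : R.Monic := monic_X_pow_sub (by
    rw [degree_X_add_C]; exact_mod_cast (by omega))
  have hRd : R.natDegree = n := by
    refine natDegree_eq_of_degree_eq_some ?_
    rw [hR, degree_sub_eq_left_of_degree_lt (by rw [degree_X_pow]; exact hdeg), degree_X_pow]
  rw [← hRd]
  refine natDegree_le_of_dvd (minpoly.dvd _ _ ?_) hmon.ne_zero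
  simp only [hR, map_sub, map_add, map_pow, aeval_X, aeval_C]
  have : algebraMap (Kur p d) (Qpbar p) ⟨b, hb⟩ = b := rfl
  rw [this]
  linear_combination hs

lemma mem_of_fixed (E : IntermediateField (Kur p d) (Qpbar p)) {x : Qpbar p}
    (h : ∀ σ : Qpbar p ≃ₐ[Kur p d] Qpbar p, (∀ y ∈ E, σ y = y) → σ x = x) : x ∈ E := by
  rw [← InfiniteGalois.fixedField_fixingSubgroup E]
  rw [IntermediateField.mem_fixedField_iff]
  intro σ hσ
  exact h σ (fun y hy => (IntermediateField.mem_fixingSubgroup_iff E σ).1 hσ y hy)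

lemma equiv_K (σ : Qpbar p ≃ₐ[Kur p d] Qpbar p) {x : Qpbar p} (hx : x ∈ Kur p d) : σ x = x :=
  σ.commutes ⟨x, hx⟩

lemma mem_of_near {m : ℕ} (hm : m ≠ 0) (E : IntermediateField (Kur p d) (Qpbar p))
    {s z b : Qpbar p} (hb : b ∈ Kur p d) (hs : s ^ (p ^ m) - s = b) (hs' : ‖s‖ ^ (p ^ m) ≤ p)
    (hz : z ∈ E) (hlt : ‖s - z‖ < 1) : s ∈ E := by
  refine mem_of_fixed E fun σ hσ => ?_
  refine root_unique hm hs' ?_ ?_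
  · rw [← map_pow, ← map_sub, hs, equiv_K σ hb]
  · have h1 : σ s - s = σ (s - z) - (s - z) := by rw [map_sub, hσ z hz]; ring
    rw [h1]
    exact nsub_lt (by rw [norm_equiv]; exact hlt) hlt

lemma Kur_int (r : ℤ) : (r : Qpbar p) ∈ Kur p d := IntermediateField.intCast_mem _ _

lemma Kur_nat (r : ℕ) : (r : Qpbar p) ∈ Kur p d := IntermediateField.natCast_mem _ _

lemma mem_Kur {t : Qpbar p} (ht : t ^ (p ^ d) = t) : t ∈ Kur p d := by
  rcases eq_or_ne t 0 with rfl | h0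
  · exact zero_mem _
  refine IntermediateField.subset_adjoin _ _ ?_
  have hpd : p ^ d = (p ^ d - 1) + 1 := by
    have : 0 < p ^ d := pow_pos (Fact.out : p.Prime).pos d
    omega
  rw [hpd, pow_succ] at ht
  exact mul_right_cancel₀ h0 (by rw [one_mul]; exact ht)

lemma pow_card_eq {t : Qpbar p} (ht : t ^ p = t) (d : ℕ) : t ^ (p ^ d) = t := by
  induction d with
  | zero => simp
  | succ d ih => rw [pow_succ, pow_mul, ih, ht]

lemma mem_adjoin_root {m : ℕ} (hm : m ≠ 0) (hT : ∀ t : Qpbar p, t ^ (p ^ m) = t → t ∈ Kur p d)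
    {s s' b : Qpbar p} (hb : b ∈ Kur p d) (hb' : ‖b‖ ≤ p) (hs : s ^ (p ^ m) - s = b)
    (hs' : s' ^ (p ^ m) - s' = b) : s' ∈ (Kur p d)⟮s⟯ := by
  have h2 := two_le_pow (p := p) hm
  obtain ⟨h3, h4⟩ := diff_roots hm (norm_root_le h2 hs hb') (norm_root_le h2 hs' hb')
    (hs.trans hs'.symm)
  obtain ⟨t, ht, ht'⟩ := approx_root (b := 0) h2 (by rw [sub_zero]; exact h4)
  have htK := hT t (sub_eq_zero.1 ht)
  refine mem_of_near hm _ hb hs' (norm_root_le h2 hs' hb') (z := s + t) ?_ ?_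
  · exact add_mem (mem_adjoin_simple_self _ s) (IntermediateField.algebraMap_mem (Kur p d)⟮s⟯ ⟨t, htK⟩)
  · rw [show s' - (s + t) = -(t - (s' - s)) by ring, norm_neg]; exact ht'

variable (p d) in
/-- The field generated over `K` by the roots of `s ^ n - s = b`. -/
noncomputable def asField (n : ℕ) (b : Qpbar p) : IntermediateField (Kur p d) (Qpbar p) :=
  IntermediateField.adjoin (Kur p d) {s : Qpbar p | s ^ n - s = b}

lemma asField_eq {m : ℕ} (hm : m ≠ 0) (hT : ∀ t : Qpbar p, t ^ (p ^ m) = t → t ∈ Kur p d)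
    {s b : Qpbar p} (hb : b ∈ Kur p d) (hb' : ‖b‖ ≤ p) (hs : s ^ (p ^ m) - s = b) :
    asField p d (p ^ m) b = (Kur p d)⟮s⟯ := by
  refine le_antisymm ?_ ?_
  · exact IntermediateField.adjoin_le_iff.2 fun s' hs' => mem_adjoin_root hm hT hb hb' hs hs'
  · exact IntermediateField.adjoin.mono _ _ _ (by simpa using hs)

lemma conv_field {n : ℕ} (hn : 2 ≤ n) {u v : Qpbar p} (hu : u ∈ Kur p d) (hv : v ∈ Kur p d)
    (hv0 : v ≠ 0) (huv : v ^ n * u = v) :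
    IntermediateField.adjoin (Kur p d)
      {x : Qpbar p | x * (x + u * (p : Qpbar p)) ^ (n - 1) + (p : Qpbar p) = 0} =
    asField p d n (-(v ^ n / p)) := by
  have hp0 : (p : Qpbar p) ≠ 0 := p_ne_zero_Q
  have hn1 : n = (n - 1) + 1 := by omega
  have hn2 : n - 1 ≠ 0 := by omega
  refine le_antisymm ?_ ?_
  · refine IntermediateField.adjoin_le_iff.2 fun x hx => ?_
    rw [Set.mem_ofPred_eq] at hx
    have hy0 : x + u * p ≠ 0 := by
      intro h
      rw [h, zero_pow hn2] at hx
      simp at hx; exact (Fact.out : p.Prime).ne_zero hx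
    have hmem : v / (x + u * p) ∈ asField p d n (-(v ^ n / p)) := by
      refine IntermediateField.subset_adjoin _ _ ?_
      rw [Set.mem_ofPred_eq]
      generalize hy : x + u * p = y at *
      have hx' : x = y - u * p := by rw [← hy]; ring
      subst hx'
      have e : y ^ n = y ^ (n - 1) * y := by conv_lhs => rw [hn1, pow_succ]
      rw [div_pow]
      field_simp
      rw [e]
      linear_combination y * (v ^ n) * hx + y * (p * y ^ (n - 1)) * huv
    have hx' : x = v / (v / (x + u * p)) - u * p := by field_simp; ring
    rw [hx']
    refine sub_mem (div_mem ?_ hmem) (mul_mem ?_ ?_)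
    · exact IntermediateField.algebraMap_mem (asField p d n (-(v ^ n / p))) ⟨v, hv⟩
    · exact IntermediateField.algebraMap_mem (asField p d n (-(v ^ n / p))) ⟨u, hu⟩
    · exact IntermediateField.natCast_mem _ _
  · refine IntermediateField.adjoin_le_iff.2 fun s hs => ?_
    rw [Set.mem_ofPred_eq] at hs
    set E := IntermediateField.adjoin (Kur p d)
      {x : Qpbar p | x * (x + u * (p : Qpbar p)) ^ (n - 1) + (p : Qpbar p) = 0} with hE
    have hs0 : s ≠ 0 := by
      rintro rfl
      rw [zero_pow (by omega)] at hs
      have : v ^ n / (p : Qpbar p) ≠ 0 := div_ne_zero (pow_ne_zero _ hv0) hp0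
      apply this
      linear_combination hs
    have hmem : v / s - u * p ∈ E := by
      refine IntermediateField.subset_adjoin _ _ ?_
      rw [Set.mem_ofPred_eq, sub_add_cancel, div_pow]
      have e : s ^ n = s ^ (n - 1) * s := by conv_lhs => rw [hn1, pow_succ]
      have e' : v ^ n = v ^ (n - 1) * v := by conv_lhs => rw [hn1, pow_succ]
      have huv' : v ^ (n - 1) * u = 1 := by
        apply mul_right_cancel₀ hv0
        rw [one_mul]; rw [e'] at huv; linear_combination huv
      rw [e, e'] at hs
      field_simp at hs ⊢
      linear_combination hs - (s * p) * huv'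
    have hs' : s = v / ((v / s - u * p) + u * p) := by
      rw [sub_add_cancel]; field_simp
    rw [hs']
    refine div_mem ?_ (add_mem hmem (mul_mem ?_ ?_))
    · exact IntermediateField.algebraMap_mem E ⟨v, hv⟩
    · exact IntermediateField.algebraMap_mem E ⟨u, hu⟩
    · exact IntermediateField.natCast_mem _ _

end helpersF
section helpersT
variable {p} {d : ℕ}

lemma norm_pow_lt {Y : Qpbar p} (hY : ‖Y‖ ^ (p ^ d) ≤ p) {i : ℕ} (hi : i < d) :
    ‖Y ^ (p ^ i)‖ < p := by
  rw [norm_pow]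
  rcases le_or_gt ‖Y‖ 1 with h | h
  · exact (pow_le_one₀ (norm_nonneg _) h).trans_lt one_lt_pR
  · exact (pow_lt_pow_right₀ h (Nat.pow_lt_pow_right (Fact.out : p.Prime).one_lt hi)).trans_le hY

lemma norm_pow_le_pp {Y : Qpbar p} (hY : ‖Y‖ ^ (p ^ d) ≤ p) {i : ℕ} (hi : i ≤ d) :
    ‖Y ^ (p ^ i)‖ ≤ p := by
  rcases hi.lt_or_eq with h | rfl
  · exact (norm_pow_lt hY h).le
  · rwa [norm_pow]

lemma tr_step {Y : Qpbar p} (hY : ‖Y‖ ^ (p ^ d) ≤ p) (j : ℕ) (hj : j ≤ d) :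
    (j < d → ‖∑ i ∈ Finset.range j, Y ^ (p ^ i)‖ ^ p < p) ∧
    ‖(∑ i ∈ Finset.range j, Y ^ (p ^ i)) ^ p - ∑ i ∈ Finset.range j, Y ^ (p ^ (i + 1))‖ < 1 := by
  have hpp : p.Prime := Fact.out
  have h1 := one_lt_pR (p := p)
  induction j with
  | zero =>
    constructor
    · intro _; simp [hpp.ne_zero]
      exact hpp.pos
    · simp [hpp.ne_zero]
  | succ j ih =>
    obtain ⟨ih1, ih2⟩ := ih (by omega)
    have ih1 := ih1 (by omega)
    have e : (Y ^ (p ^ j)) ^ p = Y ^ (p ^ (j + 1)) := by rw [← pow_mul, pow_succ]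
    rw [Finset.sum_range_succ, Finset.sum_range_succ]
    generalize hA : ∑ i ∈ Finset.range j, Y ^ (p ^ i) = A at *
    constructor
    · intro hj'
      rcases le_max_iff.1 (IsUltrametricDist.norm_add_le_max A (Y ^ (p ^ j))) with h | h
      · exact (pow_le_pow_left₀ (norm_nonneg _) h _).trans_lt ih1
      · refine (pow_le_pow_left₀ (norm_nonneg _) h _).trans_lt ?_
        rw [← norm_pow, e]
        exact norm_pow_lt hY hj'
    · have h2 := cross_lt_one (m := 1) one_ne_zero (x := A) (y := Y ^ (p ^ j))
        (by rwa [pow_one]) (by rw [pow_one, ← norm_pow, e]; exact norm_pow_le_pp hY hj)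
      rw [pow_one, e] at h2
      convert nadd_lt h2 ih2 using 2
      ring

/-- The trace-like sum. -/
noncomputable def trS (d : ℕ) (S c : Qpbar p) : Qpbar p :=
  ∑ i ∈ Finset.range d, (c * S) ^ (p ^ i)

lemma teich_norm (hd : 0 < d) {c : Qpbar p} (hc : c ^ (p ^ d) = c) : ‖c‖ ≤ 1 := by
  by_contra! h
  have h2 := two_le_pow (p := p) hd.ne'
  have h3 := norm_pow_sub h2 (Or.inr h)
  rw [hc, sub_self, norm_zero] at h3
  have : 0 < ‖c‖ ^ p ^ d := by positivity
  linarith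

lemma teich_norm_one (hd : 0 < d) {c : Qpbar p} (hc : c ^ (p ^ d) = c) (h0 : c ≠ 0) : ‖c‖ = 1 := by
  have h := congrArg norm hc
  have h2 := two_le_pow (p := p) hd.ne'
  have hn1 : p ^ d = (p ^ d - 1) + 1 := by omega
  rw [norm_pow, hn1, pow_succ] at h
  have h3 : ‖c‖ ^ (p ^ d - 1) = 1 := by
    apply mul_right_cancel₀ (norm_ne_zero_iff.2 h0)
    rw [one_mul]; exact h
  exact (pow_eq_one_iff_of_nonneg (norm_nonneg _) (by omega)).1 h3

lemma trS_approx (hd : 0 < d) {S c : Qpbar p} (hS : S ^ (p ^ d) - S = -(1 / p))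
    (hS' : ‖S‖ ^ (p ^ d) = p) (hc : c ^ (p ^ d) = c) :
    ‖trS d S c ^ p - trS d S c - (-(c / p))‖ < 1 := by
  have hY : ‖c * S‖ ^ (p ^ d) ≤ p := by
    rw [norm_mul, mul_pow, hS']
    exact mul_le_of_le_one_left (by positivity)
      (pow_le_one₀ (norm_nonneg _) (teich_norm hd hc))
  have h := (tr_step hY d le_rfl).2
  have e1 := Finset.sum_range_succ' (fun i => (c * S) ^ (p ^ i)) d
  rw [Finset.sum_range_succ] at e1
  simp only [pow_zero, pow_one] at e1
  have e2 : (c * S) ^ (p ^ d) = c * S - c / p := by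
    rw [mul_pow, hc]
    linear_combination c * hS
  unfold trS
  convert h using 2
  linear_combination -e1 + e2

lemma int_norm_lt {k : ℤ} : ‖(k : Qpbar p)‖ < 1 ↔ (p : ℤ) ∣ k := by
  rw [← map_intCast (algebraMap ℚ_[p] (Qpbar p)), norm_algebraMap', Padic.norm_intCast_lt_one_iff]

lemma nat_frob (r : ℕ) : ‖(r : Qpbar p) ^ p - r‖ < 1 := by
  have : ((r : Qpbar p) ^ p - r) = (((r : ℤ) ^ p - r : ℤ) : Qpbar p) := by push_cast; rfl
  rw [this, int_norm_lt, ← ZMod.intCast_zmod_eq_zero_iff_dvd]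
  push_cast
  rw [ZMod.pow_card, sub_self]

lemma frob_cong (hp : Odd p) {a b c : Qpbar p} (r : ℕ) (hb : ‖b‖ ≤ 1)
    (hc : ‖c‖ ≤ 1) (h : ‖a - (b - r * c)‖ < 1) : ‖a ^ p - (b ^ p - r * c ^ p)‖ < 1 := by
  have h1 := one_lt_pR (p := p)
  have hpp : p.Prime := Fact.out
  have hr : ‖(r : Qpbar p)‖ ≤ 1 := IsUltrametricDist.norm_natCast_le_one _ _
  have hrc : ‖-(r * c)‖ ≤ 1 := by rw [norm_neg, norm_mul]; exact mul_le_one₀ hr (norm_nonneg _) hc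
  have hf : ∀ x y : Qpbar p, ‖x‖ ≤ 1 → ‖y‖ ≤ 1 → ‖(x + y) ^ p - x ^ p - y ^ p‖ < 1 := by
    intro x y hx hy
    have := cross_lt_one (m := 1) one_ne_zero (x := x) (y := y)
      ((pow_le_one₀ (norm_nonneg _) hx).trans_lt h1) ((pow_le_one₀ (norm_nonneg _) hy).trans h1.le)
    rwa [pow_one] at this
  have e1 := hf b (-(r * c)) hb hrc
  have e2 := hf (b + -(r * c)) (a - (b - r * c)) (nadd_le hb hrc) h.le
  have e3 : ‖(a - (b - r * c)) ^ p‖ < 1 := by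
    rw [norm_pow]; exact pow_lt_one₀ (norm_nonneg _) h hpp.ne_zero
  have e4 : ‖((r : Qpbar p) ^ p - r) * c ^ p‖ < 1 := by
    rw [norm_mul, norm_pow]
    exact mul_lt_one_of_nonneg_of_lt_one_left (norm_nonneg _) (nat_frob r)
      (pow_le_one₀ (norm_nonneg _) hc)
  rw [show b + -(r * c) + (a - (b - r * c)) = a by ring] at e2
  rw [hp.neg_pow, mul_pow] at e1
  convert nsub_lt (nadd_lt (nadd_lt e1 e2) e3) e4 using 2
  ring

lemma trS_lin (hp : Odd p) (hd : 0 < d) {S c1 c2 c3 : Qpbar p} (r : ℕ)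
    (hS' : ‖S‖ ^ (p ^ d) = p) (hc1 : c1 ^ (p ^ d) = c1) (hc2 : c2 ^ (p ^ d) = c2)
    (hc3 : c3 ^ (p ^ d) = c3) (h : ‖c3 - (c2 - r * c1)‖ < 1) :
    ‖trS d S c3 - (trS d S c2 - r * trS d S c1)‖ < 1 := by
  have h1 := one_lt_pR (p := p)
  have hcong : ∀ i : ℕ, ‖c3 ^ (p ^ i) - (c2 ^ (p ^ i) - r * c1 ^ (p ^ i))‖ < 1 := by
    intro i
    induction i with
    | zero => simpa using h
    | succ i ih =>
      have := frob_cong hp r ?_ ?_ ih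
      · rwa [← pow_mul, ← pow_mul, ← pow_mul, ← pow_succ] at this
      · rw [norm_pow]; exact pow_le_one₀ (norm_nonneg _) (teich_norm hd hc2)
      · rw [norm_pow]; exact pow_le_one₀ (norm_nonneg _) (teich_norm hd hc1)
  have e : trS d S c3 - (trS d S c2 - r * trS d S c1) = ∑ i ∈ Finset.range d,
      (c3 ^ (p ^ i) - (c2 ^ (p ^ i) - r * c1 ^ (p ^ i))) * S ^ (p ^ i) := by
    unfold trS
    rw [Finset.mul_sum, ← Finset.sum_sub_distrib, ← Finset.sum_sub_distrib]
    refine Finset.sum_congr rfl fun i _ => ?_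
    rw [mul_pow, mul_pow, mul_pow]; ring
  rw [e]
  obtain ⟨i, hi, hle⟩ := IsUltrametricDist.exists_norm_finsetSum_le_of_nonempty
    (t := Finset.range d) ⟨0, by simpa using hd⟩
    (fun i => (c3 ^ (p ^ i) - (c2 ^ (p ^ i) - r * c1 ^ (p ^ i))) * S ^ (p ^ i))
  refine hle.trans_lt ?_
  rw [norm_mul]
  have hK : ∀ c : Qpbar p, c ^ (p ^ d) = c → c ^ (p ^ i) ∈ Kur p d := fun c hc =>
    pow_mem (mem_Kur hc) _
  have h2 := Kur_lt_one hp d hd (sub_mem (hK c3 hc3) (sub_mem (hK c2 hc2)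
    (mul_mem (Kur_nat r) (hK c1 hc1)))) (hcong i)
  have h3 := norm_pow_lt hS'.le (Finset.mem_range.1 hi)
  calc _ ≤ (p : ℝ)⁻¹ * ‖S ^ (p ^ i)‖ := by gcongr
    _ < (p : ℝ)⁻¹ * p := by gcongr
    _ = 1 := inv_mul_cancel₀ (by positivity)

/-- Every `c` with `c ^ q = c` has a root of `s ^ p - s = - c / p` close to the trace. -/
lemma exists_sc (hd : 0 < d) {S c : Qpbar p} (hS : S ^ (p ^ d) - S = -(1 / p))
    (hS' : ‖S‖ ^ (p ^ d) = p) (hc : c ^ (p ^ d) = c) :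
    ∃ s : Qpbar p, s ^ p - s = -(c / p) ∧ ‖s - trS d S c‖ < 1 ∧ s ∈ (Kur p d)⟮S⟯ := by
  obtain ⟨s, h1, h2⟩ := approx_root (Fact.out : p.Prime).two_le (trS_approx hd hS hS' hc)
  refine ⟨s, h1, h2, ?_⟩
  have hcK := mem_Kur hc
  have hb : -(c / (p : Qpbar p)) ∈ Kur p d := neg_mem (div_mem hcK (Kur_nat p))
  have hbn : ‖-(c / (p : Qpbar p))‖ ≤ p := by
    rw [norm_neg, norm_div, norm_p_Q, div_inv_eq_mul]
    exact mul_le_of_le_one_left (by positivity) (teich_norm hd hc)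
  have h3 := norm_root_le (Fact.out : p.Prime).two_le h1 hbn
  refine mem_of_near (m := 1) one_ne_zero _ hb (by rwa [pow_one]) (by rwa [pow_one])
    (z := trS d S c) ?_ h2
  exact sum_mem fun i _ => pow_mem (mul_mem
    (IntermediateField.algebraMap_mem (Kur p d)⟮S⟯ ⟨c, hcK⟩) (mem_adjoin_simple_self _ S)) _

lemma nat_unique {a b : ZMod p} (h : ‖((a.val : ℕ) : Qpbar p) - b.val‖ < 1) : a = b := by
  have : ((a.val : Qpbar p) - b.val) = (((a.val : ℤ) - b.val : ℤ) : Qpbar p) := by push_cast; rfl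
  rw [this, int_norm_lt, ← ZMod.intCast_zmod_eq_zero_iff_dvd] at h
  push_cast at h
  rw [ZMod.natCast_zmod_val, ZMod.natCast_zmod_val] at h
  exact sub_eq_zero.1 h

lemma nat_add (a b : ZMod p) : ‖(((a + b).val : ℕ) : Qpbar p) - (a.val + b.val)‖ < 1 := by
  have : (((a + b).val : Qpbar p) - (a.val + b.val)) =
    (((a + b).val - (a.val + b.val) : ℤ) : Qpbar p) := by push_cast; rfl
  rw [this, int_norm_lt, ← ZMod.intCast_zmod_eq_zero_iff_dvd]
  push_cast
  rw [ZMod.natCast_zmod_val, ZMod.natCast_zmod_val, ZMod.natCast_zmod_val, sub_self]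

lemma exists_res {D : Qpbar p} (h : ‖D ^ p - D‖ < 1) :
    ∃ a : ZMod p, ‖D - (a.val : ℕ)‖ < 1 := by
  classical
  have h2 := (Fact.out : p.Prime).two_le
  have ht : ∀ a : ZMod p, ∃ t : Qpbar p, t ^ p - t = 0 ∧ ‖t - (a.val : ℕ)‖ < 1 := fun a =>
    approx_root h2 (by rw [sub_zero]; exact nat_frob _)
  choose t ht ht' using ht
  obtain ⟨t0, h0, h0'⟩ := approx_root (b := 0) h2 (by rw [sub_zero]; exact h)
  have hinj : Function.Injective t := by
    intro a b hab
    refine nat_unique ?_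
    have := nsub_lt (ht' b) (ht' a)
    rw [hab] at this
    convert this using 2
    ring
  set R : (Qpbar p)[X] := X ^ p - X with hR
  have hmon : R.Monic := monic_X_pow_sub (by rw [degree_X]; exact_mod_cast (by omega))
  have hdeg : R.natDegree = p := FiniteField.X_pow_card_sub_X_natDegree_eq _ (by omega)
  have hroot : ∀ x : Qpbar p, x ^ p - x = 0 → x ∈ R.roots.toFinset := by
    intro x hx
    rw [Multiset.mem_toFinset, mem_roots hmon.ne_zero]
    simpa [hR] using hx
  have hsub : Finset.univ.image t ⊆ R.roots.toFinset := by
    intro x hx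
    obtain ⟨a, _, rfl⟩ := Finset.mem_image.1 hx
    exact hroot _ (ht a)
  have heq := Finset.eq_of_subset_of_card_le hsub (by
    rw [Finset.card_image_of_injective _ hinj, Finset.card_univ, ZMod.card]
    exact (Multiset.toFinset_card_le _).trans ((card_roots' _).trans hdeg.le))
  have := hroot t0 h0
  rw [← heq] at this
  obtain ⟨a, _, ha⟩ := Finset.mem_image.1 this
  refine ⟨a, ?_⟩
  have := nsub_lt (ht' a) h0'
  rw [ha] at this
  convert this using 2
  ring

end helpersT
section helpersG
variable {p} {d : ℕ}

lemma hom_card {G : Type} [Group G] [Finite G] :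
    Finite (G →* Multiplicative (ZMod p)) ∧
    Nat.card (G →* Multiplicative (ZMod p)) ≤ Nat.card G := by
  classical
  have hpp : p.Prime := Fact.out
  have : NeZero ((p : ℕ) : Qpbar p) := ⟨p_ne_zero_Q⟩
  obtain ⟨ζ, hζ⟩ := HasEnoughRootsOfUnity.exists_primitiveRoot (Qpbar p) p
  let e : Multiplicative (ZMod p) →* Qpbar p := (AddChar.zmodChar p hζ.pow_eq_one).toMonoidHom
  have he : Function.Injective e := by
    intro a b hab
    have h : ζ ^ (a.toAdd.val) = ζ ^ (b.toAdd.val) := hab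
    exact ZMod.val_injective p (hζ.pow_inj (ZMod.val_lt _) (ZMod.val_lt _) h)
  have hinj : Function.Injective (fun χ : G →* Multiplicative (ZMod p) => e.comp χ) := by
    intro a b hab
    ext g
    exact he (DFunLike.congr_fun hab g)
  have hli := (linearIndependent_monoidHom G (Qpbar p)).comp _ hinj
  have := Fintype.ofFinite G
  have hfin : Finite (G →* Multiplicative (ZMod p)) := hli.finite
  have := Fintype.ofFinite (G →* Multiplicative (ZMod p))
  refine ⟨hfin, ?_⟩
  have := hli.fintype_card_le_finrank
  rw [Module.finrank_fintype_fun_eq_card] at this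
  rwa [Nat.card_eq_fintype_card, Nat.card_eq_fintype_card]

lemma T_card (hd : 0 < d) : Finite {c : Qpbar p // c ^ (p ^ d) = c} ∧
    p ^ d ≤ Nat.card {c : Qpbar p // c ^ (p ^ d) = c} := by
  classical
  have h2 := two_le_pow (p := p) hd.ne'
  set n := p ^ d - 1 with hn
  have hn0 : 0 < n := by omega
  have hpd : p ^ d = n + 1 := by omega
  have : NeZero n := ⟨hn0.ne'⟩
  have : NeZero ((n : ℕ) : Qpbar p) := ⟨by exact_mod_cast hn0.ne'⟩
  obtain ⟨ζ, hζ⟩ := HasEnoughRootsOfUnity.exists_primitiveRoot (Qpbar p) n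
  have hset : {c : Qpbar p | c ^ (p ^ d) = c} =
      ((insert 0 (nthRootsFinset n (1 : Qpbar p)) : Finset (Qpbar p)) : Set (Qpbar p)) := by
    ext c
    rw [Set.mem_ofPred_eq, Finset.coe_insert, Set.mem_insert_iff, Finset.mem_coe,
      mem_nthRootsFinset hn0, hpd, pow_succ]
    constructor
    · intro h
      by_cases h0 : c = 0
      · exact Or.inl h0
      · exact Or.inr (mul_right_cancel₀ h0 (by rw [one_mul]; exact h))
    · rintro (rfl | h)
      · simp
      · rw [h, one_mul]
  have hfin : Finite ({c : Qpbar p | c ^ (p ^ d) = c} : Set (Qpbar p)) := by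
    rw [hset]; exact Finset.finite_toSet _
  refine ⟨hfin, ?_⟩
  have : Nat.card ({c : Qpbar p | c ^ (p ^ d) = c} : Set (Qpbar p)) = n + 1 := by
    rw [hset, Nat.card_coe_set_eq, Set.ncard_coe_finset, Finset.card_insert_of_notMem,
      hζ.card_nthRootsFinset]
    rw [mem_nthRootsFinset hn0, zero_pow hn0.ne']
    exact zero_ne_one
  exact hpd.le.trans this.ge

lemma near_T (hp : Odd p) (hd : 0 < d) {c1 c2 : Qpbar p} (r : ℕ)
    (hc1 : c1 ^ (p ^ d) = c1) (hc2 : c2 ^ (p ^ d) = c2) :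
    ∃ c3 : Qpbar p, c3 ^ (p ^ d) = c3 ∧ ‖c3 - (c2 - r * c1)‖ < 1 := by
  have hcong : ∀ i : ℕ, ‖(c2 - r * c1) ^ (p ^ i) - (c2 ^ (p ^ i) - r * c1 ^ (p ^ i))‖ < 1 := by
    intro i
    induction i with
    | zero => simp
    | succ i ih =>
      have := frob_cong hp r ?_ ?_ ih
      · rwa [← pow_mul, ← pow_mul, ← pow_mul, ← pow_succ] at this
      · rw [norm_pow]; exact pow_le_one₀ (norm_nonneg _) (teich_norm hd hc2)
      · rw [norm_pow]; exact pow_le_one₀ (norm_nonneg _) (teich_norm hd hc1)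
  have h := hcong d
  rw [hc1, hc2] at h
  obtain ⟨c3, h1, h2⟩ := approx_root (b := 0) (two_le_pow (p := p) hd.ne')
    (by rw [sub_zero]; exact h)
  exact ⟨c3, sub_eq_zero.1 h1, h2⟩

lemma T_unique (hd : 0 < d) {c c' : Qpbar p}
    (hc : c ^ (p ^ d) = c) (hc' : c' ^ (p ^ d) = c') (h : ‖c' - c‖ < 1) : c' = c := by
  refine root_unique hd.ne' ?_ (by rw [hc, hc', sub_self, sub_self]) h
  exact (pow_le_one₀ (norm_nonneg _) (teich_norm hd hc)).trans one_lt_pR.le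

lemma b_mem {c : Qpbar p} (hc : c ^ (p ^ d) = c) : -(c / (p : Qpbar p)) ∈ Kur p d :=
  neg_mem (div_mem (mem_Kur hc) (Kur_nat p))

lemma b_norm (hd : 0 < d) {c : Qpbar p} (hc : c ^ (p ^ d) = c) :
    ‖-(c / (p : Qpbar p))‖ ≤ p := by
  rw [norm_neg, norm_div, norm_p_Q, div_inv_eq_mul]
  exact mul_le_of_le_one_left (by positivity) (teich_norm hd hc)

lemma b_norm_eq (hd : 0 < d) {c : Qpbar p} (hc : c ^ (p ^ d) = c) (h0 : c ≠ 0) :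
    ‖-(c / (p : Qpbar p))‖ = p := by
  rw [norm_neg, norm_div, norm_p_Q, div_inv_eq_mul, teich_norm_one hd hc h0, one_mul]

lemma finrank_s (hp : Odd p) (hd : 0 < d) {c s : Qpbar p} (hc : c ^ (p ^ d) = c) (h0 : c ≠ 0)
    (hs : s ^ p - s = -(c / p)) : Module.finrank (Kur p d) (Kur p d)⟮s⟯ = p :=
  finrank_root hp hd (Fact.out : p.Prime).two_le (b_mem hc) (b_norm_eq hd hc h0) hs

lemma exists_moved (hp : Odd p) (hd : 0 < d) {c s : Qpbar p} (hc : c ^ (p ^ d) = c) (h0 : c ≠ 0)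
    (hs : s ^ p - s = -(c / p)) : ∃ τ : Qpbar p ≃ₐ[Kur p d] Qpbar p, τ s ≠ s := by
  by_contra! h
  have hmem : s ∈ (⊥ : IntermediateField (Kur p d) (Qpbar p)) := mem_of_fixed _ fun σ _ => h σ
  have h1 := finrank_s hp hd hc h0 hs
  rw [IntermediateField.adjoin_simple_eq_bot_iff.2 hmem, IntermediateField.finrank_bot] at h1
  exact (Fact.out : p.Prime).one_lt.ne h1

lemma root_fixed {b s : Qpbar p} (hb : b ∈ Kur p d) (hb' : ‖b‖ ≤ p) (hs : s ^ p - s = b)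
    (τ : Qpbar p ≃ₐ[Kur p d] Qpbar p) (h : ‖τ s - s‖ < 1) : τ s = s := by
  refine root_unique (m := 1) one_ne_zero ?_ ?_ h
  · rw [pow_one]; exact norm_root_le (Fact.out : p.Prime).two_le hs hb'
  · rw [pow_one, ← map_pow, ← map_sub, hs, equiv_K τ hb]

lemma exists_a {b s : Qpbar p} (hb : b ∈ Kur p d) (hb' : ‖b‖ ≤ p) (hs : s ^ p - s = b)
    (τ : Qpbar p ≃ₐ[Kur p d] Qpbar p) : ∃ a : ZMod p, ‖τ s - s - (a.val : ℕ)‖ < 1 := by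
  have hs' : τ s ^ p - τ s = b := by rw [← map_pow, ← map_sub, hs, equiv_K τ hb]
  have h2 := (Fact.out : p.Prime).two_le
  have := (diff_roots (m := 1) one_ne_zero (s := s) (s' := τ s)
    (by rw [pow_one]; exact norm_root_le h2 hs hb')
    (by rw [pow_one]; exact norm_root_le h2 hs' hb') (by rw [pow_one, hs, hs'])).2
  rw [pow_one] at this
  exact exists_res this

lemma exists_s3 (hp : Odd p) (hd : 0 < d) {S c1 c2 s1 s2 : Qpbar p} (r : ℕ)
    (hS : S ^ (p ^ d) - S = -(1 / p)) (hS' : ‖S‖ ^ (p ^ d) = p)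
    (hc1 : c1 ^ (p ^ d) = c1) (hc2 : c2 ^ (p ^ d) = c2)
    (h1 : ‖s1 - trS d S c1‖ < 1) (h2 : ‖s2 - trS d S c2‖ < 1) :
    ∃ c3 s3 : Qpbar p, c3 ^ (p ^ d) = c3 ∧ ‖c3 - (c2 - r * c1)‖ < 1 ∧
      s3 ^ p - s3 = -(c3 / p) ∧ ‖s3 - (s2 - r * s1)‖ < 1 := by
  obtain ⟨c3, hc3, h3⟩ := near_T hp hd r hc1 hc2
  obtain ⟨s3, hs3, h4, _⟩ := exists_sc hd hS hS' hc3
  refine ⟨c3, s3, hc3, h3, hs3, ?_⟩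
  have h5 := trS_lin hp hd r hS' hc1 hc2 hc3 h3
  have hr : ‖(r : Qpbar p) * (s1 - trS d S c1)‖ < 1 := by
    rw [norm_mul]
    exact mul_lt_one_of_nonneg_of_lt_one_right (IsUltrametricDist.norm_natCast_le_one _ _)
      (norm_nonneg _) h1
  convert nadd_lt (nsub_lt (nadd_lt h4 h5) h2) hr using 2
  ring

lemma dist_c (hp : Odd p) (hd : 0 < d) {S c1 c2 s1 s2 : Qpbar p}
    (hS : S ^ (p ^ d) - S = -(1 / p)) (hS' : ‖S‖ ^ (p ^ d) = p)
    (hc1 : c1 ^ (p ^ d) = c1) (hc2 : c2 ^ (p ^ d) = c2) (h01 : c1 ≠ 0)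
    (hs1 : s1 ^ p - s1 = -(c1 / p)) (hs2 : s2 ^ p - s2 = -(c2 / p))
    (h1 : ‖s1 - trS d S c1‖ < 1) (h2 : ‖s2 - trS d S c2‖ < 1)
    (hmem : s2 ∈ (Kur p d)⟮s1⟯) : (c2 / c1) ^ p = c2 / c1 := by
  obtain ⟨τ, hτ⟩ := exists_moved hp hd hc1 h01 hs1
  obtain ⟨a1, ha1⟩ := exists_a (b_mem hc1) (b_norm hd hc1) hs1 τ
  obtain ⟨a2, ha2⟩ := exists_a (b_mem hc2) (b_norm hd hc2) hs2 τ
  have ha10 : a1 ≠ 0 := by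
    rintro rfl
    refine hτ (root_fixed (b_mem hc1) (b_norm hd hc1) hs1 τ ?_)
    simpa using ha1
  set r := (a2 / a1).val with hr
  obtain ⟨c3, s3, hc3, h3, hs3, h4⟩ := exists_s3 hp hd r hS hS' hc1 hc2 h1 h2
  by_cases h03 : c3 = 0
  · have e1 : ‖c2 / c1 - r‖ < 1 := by
      have : c2 / c1 - r = (c2 - r * c1) / c1 := by field_simp
      rw [this, norm_div, teich_norm_one hd hc1 h01, div_one]
      rwa [h03, zero_sub, norm_neg] at h3
    have hcq : (c2 / c1) ^ (p ^ d) = c2 / c1 := by rw [div_pow, hc1, hc2]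
    refine T_unique hd hcq (by rw [← pow_mul, mul_comm, pow_mul, hcq]) ?_
    have e2 := frob_cong hp 0 (a := c2 / c1) (b := (r : Qpbar p)) (c := 0)
      (IsUltrametricDist.norm_natCast_le_one _ _) (by simp) (by simpa using e1)
    simp only [Nat.cast_zero, zero_mul, sub_zero] at e2
    convert nadd_lt e2 (nsub_lt (nat_frob r) e1) using 2
    ring
  · exfalso
    have hfix : τ s3 = s3 := by
      refine root_fixed (b_mem hc3) (b_norm hd hc3) hs3 τ ?_
      have e1 : ‖τ (s3 - (s2 - r * s1))‖ < 1 := by rw [norm_equiv]; exact h4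
      have e2 : ‖(r : Qpbar p) * (τ s1 - s1 - (a1.val : ℕ))‖ < 1 := by
        rw [norm_mul]
        exact mul_lt_one_of_nonneg_of_lt_one_right (IsUltrametricDist.norm_natCast_le_one _ _)
          (norm_nonneg _) ha1
      have e3 : ‖((a2.val : ℕ) : Qpbar p) - r * (a1.val : ℕ)‖ < 1 := by
        have : ((a2.val : Qpbar p) - r * a1.val) =
          (((a2.val : ℤ) - r * a1.val : ℤ) : Qpbar p) := by push_cast; rfl
        rw [this, int_norm_lt, ← ZMod.intCast_zmod_eq_zero_iff_dvd]
        push_cast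
        rw [hr, ZMod.natCast_zmod_val, ZMod.natCast_zmod_val, ZMod.natCast_zmod_val,
          div_mul_cancel₀ _ ha10, sub_self]
      have e4 := nadd_lt (nsub_lt (nadd_lt (nsub_lt e1 h4) ha2) e2) e3
      convert e4 using 2
      simp only [map_sub, map_mul, map_natCast]
      ring
    have hm3 : s3 ∈ (Kur p d)⟮s1⟯ := by
      refine mem_of_near (m := 1) one_ne_zero _ (b_mem hc3) (by rwa [pow_one])
        (by rw [pow_one]; exact norm_root_le (Fact.out : p.Prime).two_le hs3 (b_norm hd hc3))
        (z := s2 - r * s1) ?_ h4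
      exact sub_mem hmem (mul_mem (IntermediateField.natCast_mem _ _)
        (mem_adjoin_simple_self _ s1))
    have hle : (Kur p d)⟮s3⟯ ≤ (Kur p d)⟮s1⟯ := IntermediateField.adjoin_simple_le_iff.2 hm3
    have : FiniteDimensional (Kur p d) (Kur p d)⟮s1⟯ :=
      IntermediateField.adjoin.finiteDimensional (Algebra.IsIntegral.isIntegral s1)
    have heq := IntermediateField.eq_of_le_of_finrank_eq hle
      ((finrank_s hp hd hc3 h03 hs3).trans (finrank_s hp hd hc1 h01 hs1).symm)
    have hm1 : s1 ∈ (Kur p d)⟮s3⟯ := by rw [heq]; exact mem_adjoin_simple_self _ s1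
    have hle2 : (Kur p d)⟮s3⟯ ≤ IntermediateField.fixedField (Subgroup.zpowers τ) := by
      refine IntermediateField.adjoin_simple_le_iff.2 ?_
      rw [IntermediateField.mem_fixedField_iff]
      intro f hf
      obtain ⟨k, rfl⟩ := Subgroup.mem_zpowers_iff.1 hf
      have : τ ∈ MulAction.stabilizer (Qpbar p ≃ₐ[Kur p d] Qpbar p) s3 := hfix
      exact zpow_mem this k
    have := hle2 hm1
    rw [IntermediateField.mem_fixedField_iff] at this
    exact hτ (this τ (Subgroup.mem_zpowers τ))

lemma exists_char (M : IntermediateField (Kur p d) (Qpbar p)) {b s : Qpbar p}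
    (hb : b ∈ Kur p d) (hb' : ‖b‖ ≤ p) (hs : s ^ p - s = b) (hM : s ∈ M) :
    ∃ χ : (M ≃ₐ[Kur p d] M) →* Multiplicative (ZMod p),
      ∀ σ : M ≃ₐ[Kur p d] M, ‖((σ ⟨s, hM⟩ : M) : Qpbar p) - s - ((χ σ).toAdd.val : ℕ)‖ < 1 := by
  have hlift : ∀ σ : M ≃ₐ[Kur p d] M, ∃ τ : Qpbar p ≃ₐ[Kur p d] Qpbar p,
      ∀ x : M, τ x = (σ x : M) := fun σ =>
    ⟨σ.liftNormal (Qpbar p), fun x => σ.liftNormal_commutes (Qpbar p) x⟩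
  choose τ hτ using hlift
  have ha := fun σ => exists_a hb hb' hs (τ σ)
  choose a ha using ha
  have hτs : ∀ σ, τ σ s = ((σ ⟨s, hM⟩ : M) : Qpbar p) := fun σ => hτ σ ⟨s, hM⟩
  refine ⟨MonoidHom.mk' (fun σ => Multiplicative.ofAdd (a σ)) ?_, ?_⟩
  · intro σ σ'
    rw [← ofAdd_add]
    congr 1
    apply nat_unique
    have e0 : τ (σ * σ') s = τ σ (τ σ' s) := by rw [hτs, hτs, hτ]; rfl
    have e1 := ha (σ * σ')
    have e2 : ‖τ σ (τ σ' s - s - (a σ').val)‖ < 1 := by rw [norm_equiv]; exact ha σ'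
    have e3 := nsub_lt (nsub_lt (nadd_lt e2 (ha σ)) e1) (nat_add (a σ) (a σ'))
    convert e3 using 2
    rw [e0]
    simp only [map_sub, map_natCast]
    ring
  · intro σ
    have := ha σ
    rw [hτs] at this
    exact this

end helpersG
section helpersH
variable {p} {d : ℕ}

lemma normal_asField {n : ℕ} {b : Qpbar p} (hb : b ∈ Kur p d) :
    Normal (Kur p d) (asField p d n b) := by
  rw [IntermediateField.normal_iff_forall_map_le']
  intro σ
  unfold asField
  rw [IntermediateField.adjoin_map]
  refine IntermediateField.adjoin.mono _ _ _ ?_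
  rintro _ ⟨s, hs, rfl⟩
  rw [Set.mem_ofPred_eq] at hs ⊢
  have : σ s ^ n - σ s = b := by rw [← map_pow, ← map_sub, hs, equiv_K σ hb]
  exact this

lemma surj_c (hp : Odd p) (hd : 0 < d) {S : Qpbar p}
    (hS : S ^ (p ^ d) - S = -(1 / p)) (hS' : ‖S‖ ^ (p ^ d) = p)
    (M : IntermediateField (Kur p d) (Qpbar p)) (hM : M = (Kur p d)⟮S⟯)
    (hN : Normal (Kur p d) M) (hr : Module.finrank (Kur p d) M = p ^ d)
    (F : IntermediateField (Kur p d) (Qpbar p)) (hF : F ≤ M)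
    (hFr : Module.finrank (Kur p d) F = p) :
    ∃ c s : Qpbar p, c ^ (p ^ d) = c ∧ c ≠ 0 ∧ s ^ p - s = -(c / p) ∧ F = (Kur p d)⟮s⟯ := by
  have hpp : p.Prime := Fact.out
  have hpd0 : 0 < p ^ d := pow_pos hpp.pos d
  have hfd : FiniteDimensional (Kur p d) M := Module.finite_of_finrank_pos (by omega)
  have hgal : IsGalois (Kur p d) M := {}
  have hG : Nat.card (M ≃ₐ[Kur p d] M) = p ^ d := by
    rw [IsGalois.card_aut_eq_finrank, hr]
  have hex : ∀ c : {c : Qpbar p // c ^ (p ^ d) = c}, ∃ (s : Qpbar p) (hs : s ∈ M)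
      (χ : (M ≃ₐ[Kur p d] M) →* Multiplicative (ZMod p)),
      s ^ p - s = -(c.1 / p) ∧ ‖s - trS d S c.1‖ < 1 ∧
      ∀ σ : M ≃ₐ[Kur p d] M,
        ‖((σ ⟨s, hs⟩ : M) : Qpbar p) - s - ((χ σ).toAdd.val : ℕ)‖ < 1 := by
    rintro ⟨c, hc⟩
    obtain ⟨s, h1, h2, h3⟩ := exists_sc hd hS hS' hc
    rw [← hM] at h3
    obtain ⟨χ, hχ⟩ := exists_char M (b_mem hc) (b_norm hd hc) h1 h3
    exact ⟨s, h3, χ, h1, h2, hχ⟩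
  choose s hsM χ hs hst hχ using hex
  have hres : ∀ τ : Qpbar p ≃ₐ[Kur p d] Qpbar p, ∀ x : M,
      ((τ.restrictNormal M x : M) : Qpbar p) = τ x := fun τ x =>
    τ.restrictNormal_commutes M x
  have hinj : Function.Injective χ := by
    rintro c1 c2 h12
    by_contra hne
    obtain ⟨c3, s3, hc3, h3, hs3, h4⟩ := exists_s3 hp hd 1 hS hS' c1.2 c2.2 (hst c1) (hst c2)
    rw [Nat.cast_one, one_mul] at h3 h4
    have h03 : c3 ≠ 0 := by
      rintro rfl
      rw [zero_sub, norm_neg] at h3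
      exact hne (Subtype.ext (T_unique hd c1.2 c2.2 h3).symm)
    obtain ⟨τ, hτ⟩ := exists_moved hp hd hc3 h03 hs3
    refine hτ (root_fixed (b_mem hc3) (b_norm hd hc3) hs3 τ ?_)
    have e1 := hχ c1 (τ.restrictNormal M)
    have e2 := hχ c2 (τ.restrictNormal M)
    rw [hres] at e1 e2
    rw [h12] at e1
    have e3 : ‖τ (s3 - (s c2 - s c1))‖ < 1 := by rw [norm_equiv]; exact h4
    convert nadd_lt (nsub_lt e3 h4) (nsub_lt e2 e1) using 2
    simp only [map_sub]
    ring
  obtain ⟨hTfin, hT⟩ := T_card (p := p) hd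
  obtain ⟨hHfin, hH⟩ := hom_card (p := p) (G := M ≃ₐ[Kur p d] M)
  have hbij : Function.Bijective χ :=
    hinj.bijective_of_nat_card_le (hH.trans (hG.le.trans hT))
  set F' : IntermediateField (Kur p d) M := IntermediateField.restrict hF with hF'
  have hF'r : Module.finrank (Kur p d) F' = p := by
    exact (IntermediateField.restrictAlgEquiv hF).toLinearEquiv.finrank_eq.symm.trans hFr
  set H := F'.fixingSubgroup with hHdef
  have hidx : H.index = p :=
    (IntermediateField.finrank_eq_fixingSubgroup_index _ F').symm.trans hF'r
  have hHn : H.Normal := by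
    refine Subgroup.normal_of_index_eq_minFac_card ?_
    rw [hidx, hG, hpp.pow_minFac hd.ne']
  have hcq : Nat.card ((M ≃ₐ[Kur p d] M) ⧸ H) = p := hidx
  have hcyc : IsCyclic ((M ≃ₐ[Kur p d] M) ⧸ H) := isCyclic_of_prime_card hcq
  have hcyc2 : IsCyclic (Multiplicative (ZMod p)) := inferInstance
  let e : ((M ≃ₐ[Kur p d] M) ⧸ H) ≃* Multiplicative (ZMod p) :=
    mulEquivOfCyclicCardEq (by rw [hcq]; simp)
  obtain ⟨c, hc⟩ := hbij.2 (e.toMonoidHom.comp (QuotientGroup.mk' H))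
  have hker : ∀ σ, χ c σ = 1 ↔ σ ∈ H := by
    intro σ
    rw [hc]
    simp
  have hc0 : c.1 ≠ 0 := by
    intro h0
    have htop : H = ⊤ := by
      rw [eq_top_iff]
      intro σ _
      rw [← hker]
      have e1 := hs c
      rw [h0, zero_div, neg_zero, sub_eq_zero] at e1
      have e2 : s c ∈ Kur p d := mem_Kur (pow_card_eq e1 d)
      have e3 : σ ⟨s c, hsM c⟩ = ⟨s c, hsM c⟩ := σ.commutes ⟨s c, e2⟩
      have e4 := hχ c σ
      rw [e3] at e4
      have e5 : (χ c σ).toAdd = 0 := by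
        apply nat_unique
        have e6 : ‖s c - s c - ((χ c σ).toAdd.val : Qpbar p)‖ < 1 := e4
        rw [sub_self, zero_sub, norm_neg] at e6
        rw [ZMod.val_zero, Nat.cast_zero, sub_zero]
        exact e6
      exact e5
    rw [htop, Subgroup.index_top] at hidx
    exact hpp.one_lt.ne hidx
  refine ⟨c.1, s c, c.2, hc0, hs c, ?_⟩
  have hmem : s c ∈ F := by
    have : (⟨s c, hsM c⟩ : M) ∈ F' := by
      rw [← IsGalois.fixedField_fixingSubgroup F', IntermediateField.mem_fixedField_iff]
      intro σ hσ
      have e1 := hχ c σ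
      rw [(hker σ).2 hσ, toAdd_one, ZMod.val_zero, Nat.cast_zero, sub_zero] at e1
      have e2 := σ.liftNormal_commutes (Qpbar p) ⟨s c, hsM c⟩
      apply Subtype.ext
      refine Eq.trans e2.symm ?_
      refine root_fixed (b_mem c.2) (b_norm hd c.2) (hs c) _ ?_
      refine lt_of_eq_of_lt ?_ e1
      exact congrArg (fun z => ‖z - s c‖) e2
    exact (IntermediateField.mem_restrict hF _).1 this
  have hFfd : FiniteDimensional (Kur p d) F := Module.finite_of_finrank_pos (by
    rw [hFr]; exact hpp.pos)
  exact (IntermediateField.eq_of_le_of_finrank_eq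
    (IntermediateField.adjoin_simple_le_iff.2 hmem)
    ((finrank_s hp hd c.2 hc0 (hs c)).trans hFr.symm)).symm

end helpersH
section helpersI
variable {p} {d : ℕ}

lemma v_pow {v : Qpbar p} (hv : v ^ (p ^ d - 1) = 1) : v ^ (p ^ d) = v := by
  have : 0 < p ^ d := pow_pos (Fact.out : p.Prime).pos d
  have hpd : p ^ d = (p ^ d - 1) + 1 := by omega
  rw [hpd, pow_succ, hv, one_mul]

lemma v_ne (hd : 0 < d) {v : Qpbar p} (hv : v ^ (p ^ d - 1) = 1) : v ≠ 0 := by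
  have := two_le_pow (p := p) hd.ne'
  rintro rfl
  rw [zero_pow (by omega)] at hv
  exact zero_ne_one hv

lemma vp_pow {v : Qpbar p} (hv : v ^ (p ^ d) = v) : (v ^ p) ^ (p ^ d) = v ^ p := by
  rw [← pow_mul, mul_comm, pow_mul, hv]

lemma Mfield_eq (hd : 0 < d) {v s : Qpbar p} (hv : v ^ (p ^ d - 1) = 1)
    (hs : s ^ p - s = -(v ^ p / p)) :
    Mfield p d (v ^ ((1 : ℤ) - (p : ℤ))) = (Kur p d)⟮s⟯ := by
  have hpp : p.Prime := Fact.out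
  have hvq := v_pow hv
  have hv0 := v_ne hd hv
  have hvK := mem_Kur hvq
  have h1 := conv_field (d := d) hpp.two_le (u := v ^ ((1 : ℤ) - (p : ℤ))) (zpow_mem hvK _) hvK hv0
    (by rw [← zpow_natCast, ← zpow_add₀ hv0]; simp)
  have h2 := asField_eq (m := 1) (d := d) one_ne_zero
    (fun t ht => mem_Kur (pow_card_eq (by rwa [pow_one] at ht) d))
    (b_mem (vp_pow hvq)) (b_norm hd (vp_pow hvq)) (by rw [pow_one]; exact hs)
  rw [pow_one] at h2
  rw [← h2, ← h1]
  unfold Mfield psiPoly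
  congr 1
  ext x
  simp

lemma Mp2K_eq (hd : 0 < d) : Mp2K p d = asField p d (p ^ d) (-(1 / p)) := by
  have h1 := conv_field (d := d) (p := p) (two_le_pow (p := p) hd.ne') (u := 1) (v := 1)
    (one_mem _) (one_mem _) one_ne_zero (by simp)
  rw [one_pow] at h1
  rw [← h1]
  unfold Mp2K
  congr 1
  ext x
  simp

lemma exists_S (hd : 0 < d) : ∃ S : Qpbar p, S ^ (p ^ d) - S = -(1 / p) ∧ ‖S‖ ^ (p ^ d) = p ∧
    Mp2K p d = (Kur p d)⟮S⟯ := by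
  have h2 := two_le_pow (p := p) hd.ne'
  obtain ⟨S, hS⟩ := exists_root h2 (-(1 / p) : Qpbar p)
  have h1 : (1 : Qpbar p) ^ (p ^ d) = 1 := one_pow _
  refine ⟨S, hS, norm_root_eq h2 hS (b_norm_eq hd h1 one_ne_zero), ?_⟩
  rw [Mp2K_eq hd]
  exact asField_eq hd.ne' (fun t ht => mem_Kur ht) (b_mem h1) (b_norm hd h1) hS

end helpersI
/-- `[M_{p,2} : K] = q = p^d`; for each `v ∈ μ_{q-1}` the field
`M_{v^{1-p}}` is an intermediate field of `M_{p,2}/K` of degree `p` over `K`; two such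
coincide iff `v₁ v₂⁻¹ ∈ μ_{p-1}`; and every intermediate field of `M_{p,2}/K` of degree
`p` over `K` is of the form `M_{v^{1-p}}`.  Hence `v ↦ M_{v^{1-p}}` induces a bijection
from `μ_{q-1}/μ_{p-1}` onto the set of degree-`p` intermediate fields of `M_{p,2}/K`. -/
theorem statement19 (hp : Odd p) (d : ℕ) (hd : 0 < d) :
    Module.finrank (Kur p d) (Mp2K p d) = p ^ d ∧
    (∀ v : Qpbar p, v ^ (p ^ d - 1) = 1 →
      Mfield p d (v ^ ((1 : ℤ) - (p : ℤ))) ≤ Mp2K p d ∧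
      Module.finrank (Kur p d) (Mfield p d (v ^ ((1 : ℤ) - (p : ℤ)))) = p) ∧
    (∀ v₁ v₂ : Qpbar p, v₁ ^ (p ^ d - 1) = 1 → v₂ ^ (p ^ d - 1) = 1 →
      (Mfield p d (v₁ ^ ((1 : ℤ) - (p : ℤ))) = Mfield p d (v₂ ^ ((1 : ℤ) - (p : ℤ))) ↔
        (v₁ * v₂⁻¹) ^ (p - 1) = 1)) ∧
    (∀ F : IntermediateField (Kur p d) (Qpbar p),
      F ≤ Mp2K p d → Module.finrank (Kur p d) F = p →
        ∃ v : Qpbar p, v ^ (p ^ d - 1) = 1 ∧ F = Mfield p d (v ^ ((1 : ℤ) - (p : ℤ)))) := by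
  have hpp : p.Prime := Fact.out
  have h1 : (1 : Qpbar p) ^ (p ^ d) = 1 := one_pow _
  have h2 := two_le_pow (p := p) hd.ne'
  obtain ⟨S, hS, hS', hM⟩ := exists_S (p := p) hd
  have hr : Module.finrank (Kur p d) (Mp2K p d) = p ^ d := by
    rw [hM]
    exact finrank_root hp hd h2 (b_mem h1) (b_norm_eq hd h1 one_ne_zero) hS
  refine ⟨hr, ?_, ?_, ?_⟩
  · intro v hv
    have hvq := v_pow hv
    obtain ⟨s, hs, _, hsM⟩ := exists_sc hd hS hS' (vp_pow hvq)
    rw [Mfield_eq hd hv hs, hM]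
    exact ⟨IntermediateField.adjoin_simple_le_iff.2 hsM,
      finrank_s hp hd (vp_pow hvq) (pow_ne_zero _ (v_ne hd hv)) hs⟩
  · intro v₁ v₂ hv₁ hv₂
    have h01 := v_ne hd hv₁
    have h02 := v_ne hd hv₂
    constructor
    · intro h
      have hq₁ := v_pow hv₁
      have hq₂ := v_pow hv₂
      obtain ⟨s₁, hs₁, ht₁, _⟩ := exists_sc hd hS hS' (vp_pow hq₁)
      obtain ⟨s₂, hs₂, ht₂, _⟩ := exists_sc hd hS hS' (vp_pow hq₂)
      rw [Mfield_eq hd hv₁ hs₁, Mfield_eq hd hv₂ hs₂] at h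
      have hmem : s₁ ∈ (Kur p d)⟮s₂⟯ := by rw [← h]; exact mem_adjoin_simple_self _ s₁
      have h3 := dist_c hp hd hS hS' (vp_pow hq₂) (vp_pow hq₁) (pow_ne_zero _ h02)
        hs₂ hs₁ ht₂ ht₁ hmem
      rw [← div_pow, div_eq_mul_inv] at h3
      set w := v₁ * v₂⁻¹ with hw
      have hw0 : w ≠ 0 := mul_ne_zero h01 (inv_ne_zero h02)
      have hwq : w ^ (p ^ d) = w := by rw [hw, mul_pow, inv_pow, hq₁, hq₂]
      have h4 := congrArg (fun z => z ^ (p ^ (d - 1))) h3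
      have e1 : (w ^ p) ^ (p ^ (d - 1)) = w := by
        rw [← pow_mul, ← pow_succ', Nat.sub_add_cancel hd, hwq]
      rw [← pow_mul, mul_comm, pow_mul, e1] at h4
      have hp1 : p = (p - 1) + 1 := by have := hpp.two_le; omega
      have h5 : w ^ ((p - 1) + 1) = w := by rw [← hp1]; exact h4
      rw [pow_succ] at h5
      exact mul_right_cancel₀ hw0 (by rw [one_mul]; exact h5)
    · intro h
      have h3 : v₁ ^ (p - 1) = v₂ ^ (p - 1) := by
        rw [mul_pow, inv_pow] at h
        exact (mul_inv_eq_one₀ (pow_ne_zero _ h02)).1 h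
      have e : ((1 : ℤ) - (p : ℤ)) = -((p - 1 : ℕ) : ℤ) := by
        have := hpp.two_le; omega
      rw [e, zpow_neg, zpow_neg, zpow_natCast, zpow_natCast, h3]
  · intro F hF hFr
    have hN : Normal (Kur p d) (Mp2K p d) := by
      rw [Mp2K_eq hd]; exact normal_asField (b_mem h1)
    obtain ⟨c, s, hc, hc0, hs, hFs⟩ := surj_c hp hd hS hS' _ hM hN hr F hF hFr
    have hvc : (c ^ (p ^ (d - 1))) ^ p = c := by
      rw [← pow_mul, ← pow_succ, Nat.sub_add_cancel hd, hc]
    have hc1 : c ^ (p ^ d - 1) = 1 := by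
      have hpd : p ^ d = (p ^ d - 1) + 1 := by omega
      rw [hpd, pow_succ] at hc
      exact mul_right_cancel₀ hc0 (by rw [one_mul]; exact hc)
    have hv : (c ^ (p ^ (d - 1))) ^ (p ^ d - 1) = 1 := by
      rw [← pow_mul, mul_comm, pow_mul, hc1, one_pow]
    refine ⟨c ^ (p ^ (d - 1)), hv, ?_⟩
    rw [hFs, Mfield_eq hd hv (s := s) (by rw [hvc]; exact hs)]
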